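/- arXiv:2604.14501 — 3 statements merged into one kernel-verified Lean document; each statement's English description precedes it below -/
import Mathlib

section
/- Every element A of the general linear group GL(3, ZMod 2) (invertible 3×3 matrices over the field with two elements) has order belonging to the set {1, 2, 3, 4, 7}. -/
open scoped MatrixGroups

open Polynomial in
/-- A monic cubic over `𝔽₂` with nonzero constant coefficient divides `X ^ n - 1`
for some `n ∈ {3, 4, 7}`. -/
theorem exists_dvd_X_pow_sub_one_of_monic_cubic (p : (ZMod 2)[X]) (hp : p.Monic)
    (hdeg : p.natDegree = 3) (h0 : p.coeff 0 ≠ 0) :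
    p ∣ X ^ 3 - 1 ∨ p ∣ X ^ 4 - 1 ∨ p ∣ X ^ 7 - 1 := by
  have htwo : (2 : (ZMod 2)[X]) = 0 := CharTwo.two_eq_zero
  have hbit : ∀ a : ZMod 2, a = 0 ∨ a = 1 := by decide
  have h0' : p.coeff 0 = 1 := (hbit _).resolve_left h0
  have hsum := hp.as_sum
  simp only [hdeg, Finset.sum_range_succ, Finset.sum_range_zero, h0'] at hsum
  rcases hbit (p.coeff 1) with h1 | h1 <;> rcases hbit (p.coeff 2) with h2 | h2 <;>
    simp only [h1, h2, map_zero, map_one] at hsum <;> rw [hsum]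
  · exact Or.inl ⟨1, by linear_combination -htwo⟩
  · exact Or.inr (Or.inr ⟨(X + 1) * (X ^ 3 + X + 1),
      by linear_combination (-X ^ 6 - X ^ 5 - 2 * X ^ 4 - 2 * X ^ 3 - X ^ 2 - X - 1) * htwo⟩)
  · exact Or.inr (Or.inr ⟨(X + 1) * (X ^ 3 + X ^ 2 + 1),
      by linear_combination (-X ^ 6 - X ^ 5 - 2 * X ^ 4 - 2 * X ^ 3 - X ^ 2 - X - 1) * htwo⟩)
  · exact Or.inr (Or.inl ⟨X + 1, by linear_combination (-X ^ 3 - X ^ 2 - X - 1) * htwo⟩)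

/-- **Possible element orders in `GL(3, 𝔽₂)`.**
Every element of the general linear group of invertible `3 × 3` matrices over `ZMod 2`
has order `1`, `2`, `3`, `4`, or `7`. -/
theorem orderOf_GL3_F2_mem (A : GL (Fin 3) (ZMod 2)) :
    orderOf A ∈ ({1, 2, 3, 4, 7} : Set ℕ) := by
  have h0 : A.val.charpoly.coeff 0 ≠ 0 := by
    intro h
    have hdet := Matrix.det_eq_sign_charpoly_coeff A.val
    rw [h, mul_zero] at hdet
    exact ((Matrix.isUnit_iff_isUnit_det _).mp A.isUnit).ne_zero hdet
  have horder : ∀ n : ℕ, A.val.charpoly ∣ Polynomial.X ^ n - 1 → orderOf A ∣ n := by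
    intro n hn
    have h := Polynomial.aeval_eq_zero_of_dvd_aeval_eq_zero hn A.val.aeval_self_charpoly
    rw [map_sub, map_pow, Polynomial.aeval_X, map_one, sub_eq_zero] at h
    exact orderOf_dvd_of_pow_eq_one (Units.ext (by simpa using h))
  have hcases : orderOf A ∣ 3 ∨ orderOf A ∣ 4 ∨ orderOf A ∣ 7 :=
    (exists_dvd_X_pow_sub_one_of_monic_cubic _ A.val.charpoly_monic
      (by simp [Matrix.charpoly_natDegree_eq_dim]) h0).imp (horder 3)
      (Or.imp (horder 4) (horder 7))
  generalize orderOf A = k at hcases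
  have hk : k ≤ 7 := by
    rcases hcases with h | h | h <;> linarith [Nat.le_of_dvd (by norm_num) h]
  interval_cases k <;> simp_all
end

section
/- No affine permutation of (ZMod 2)³ has order 8. That is, for every invertible 3×3 matrix A over ZMod 2 and every vector b ∈ (Fin 3 → ZMod 2), the bijection f of (Fin 3 → ZMod 2) given by f(x) = A.mulVec x + b satisfies orderOf f ≠ 8 (as an element of the group of permutations of (Fin 3 → ZMod 2)). -/
/-- A nilpotent `n × n` matrix over an integral domain has vanishing `n`-th power. -/
theorem Matrix.pow_card_eq_zero_of_isNilpotent {n R : Type*} [Fintype n] [DecidableEq n]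
    [CommRing R] [IsDomain R] {N : Matrix n n R} (hN : IsNilpotent N) :
    N ^ Fintype.card n = 0 := by
  have h := (Matrix.isNilpotent_charpoly_sub_pow_of_isNilpotent hN).eq_zero
  simpa [sub_eq_zero.mp h] using N.aeval_self_charpoly

/-- Iterates of the affine map `x ↦ A x + b`. -/
theorem Equiv.Perm.pow_apply_of_affine {n R : Type*} [Fintype n] [DecidableEq n] [CommRing R]
    {A : Matrix n n R} {b : n → R} {f : Equiv.Perm (n → R)}
    (hf : ∀ x, f x = A.mulVec x + b) (k : ℕ) (x : n → R) :
    (f ^ k) x = (A ^ k).mulVec x + (∑ i ∈ Finset.range k, A ^ i).mulVec b := by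
  induction k with
  | zero => simp
  | succ k ih =>
    rw [pow_succ', Equiv.Perm.mul_apply, ih, hf, Matrix.mulVec_add, Matrix.mulVec_mulVec,
      Matrix.mulVec_mulVec, geom_sum_succ, Matrix.add_mulVec, Matrix.one_mulVec, pow_succ',
      add_assoc]

/-- **No affine permutation of `𝔽₂³` has order 8.** For every invertible `3 × 3` matrix `A`
over `ZMod 2` and every `b : Fin 3 → ZMod 2`, a permutation `f` of `Fin 3 → ZMod 2` given by
`f(x) = A.mulVec x + b` does not have order `8`. -/
theorem no_affine_perm_order_eight (A : Matrix (Fin 3) (Fin 3) (ZMod 2)) (hA : IsUnit A)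
    (b : Fin 3 → ZMod 2) (f : Equiv.Perm (Fin 3 → ZMod 2))
    (hf : ∀ x, f x = A.mulVec x + b) : orderOf f ≠ 8 := by
  intro h
  have h_iter := Equiv.Perm.pow_apply_of_affine hf
  have hf8 : f ^ 8 = 1 := h ▸ pow_orderOf_eq_one f
  have hA8 : A ^ 8 = 1 := by
    have h0 := h_iter 8 0
    simp only [hf8, Equiv.Perm.one_apply, Matrix.mulVec_zero, zero_add] at h0
    refine Matrix.ext_of_mulVec_single fun i => ?_
    rw [Matrix.one_mulVec]
    simpa only [hf8, Equiv.Perm.one_apply, ← h0, add_zero] using (h_iter 8 (Pi.single i 1)).symm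
  have h_frob (k : ℕ) : (A - 1) ^ 2 ^ k = A ^ 2 ^ k - 1 := by
    simpa using sub_pow_char_pow_of_commute (p := 2) (n := k) (Commute.one_right A)
  have hN3 : (A - 1) ^ 3 = 0 :=
    Matrix.pow_card_eq_zero_of_isNilpotent ⟨8, by simpa [hA8] using h_frob 3⟩
  have hA4 : A ^ 4 = 1 := by
    rw [← sub_eq_zero, show 4 = 2 ^ 2 from rfl, ← h_frob 2]
    exact pow_eq_zero_of_le (by norm_num) hN3
  have h_sum : ∑ i ∈ Finset.range 4, A ^ i = 0 := by
    have h2 : (2 : Matrix (Fin 3) (Fin 3) (ZMod 2)) = 0 := CharTwo.two_eq_zero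
    calc ∑ i ∈ Finset.range 4, A ^ i = (A - 1) ^ 3 + 2 * (2 * A ^ 2 - A + 1) := by
          simp only [Finset.sum_range_succ, Finset.sum_range_zero]
          noncomm_ring
      _ = 0 := by rw [hN3, h2, zero_mul, add_zero]
  have hf4 : f ^ 4 = 1 := by
    ext1 x
    simp [h_iter, hA4, h_sum]
  have h_dvd := orderOf_dvd_of_pow_eq_one hf4
  rw [h] at h_dvd
  omega
end

section
/- For every invertible 3×3 matrix A over ZMod 2, every vector b ∈ (Fin 3 → ZMod 2), and every point x ∈ (Fin 3 → ZMod 2), the eight iterates f^[0](x), f^[1](x), …, f^[7](x) of the affine map f(y) = A.mulVec y + b are not pairwise distinct. -/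
theorem Matrix.iterate_mulVec_add {ι R : Type*} [Fintype ι] [DecidableEq ι] [CommRing R]
    (A : Matrix ι ι R) (b x : ι → R) (n : ℕ) :
    (fun y => A.mulVec y + b)^[n] x =
      x + (∑ k ∈ Finset.range n, A ^ k).mulVec (A.mulVec x + b - x) := by
  induction n with
  | zero => simp
  | succ n ih =>
    rw [Function.iterate_succ_apply', ih, geom_sum_succ]
    simp only [Matrix.add_mulVec, Matrix.mulVec_add, Matrix.one_mulVec, ← Matrix.mulVec_mulVec]
    abel

theorem Polynomial.dvd_geom_sum_of_monic_cubic_zmod_two {p : Polynomial (ZMod 2)}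
    (hp : p.Monic) (hdeg : p.natDegree = 3) (h0 : p.coeff 0 ≠ 0) :
    ∃ n : Fin 8, n ≠ 0 ∧ p ∣ ∑ k ∈ Finset.range n, Polynomial.X ^ k := by
  have zmod_cases : ∀ c : ZMod 2, c = 0 ∨ c = 1 := by decide
  have two_eq_zero : (2 : Polynomial (ZMod 2)) = 0 := CharTwo.two_eq_zero
  have c0 : p.coeff 0 = 1 := (zmod_cases _).resolve_left h0
  have c3 : p.coeff 3 = 1 := hdeg ▸ hp.coeff_natDegree
  have hsum := p.as_sum_range_C_mul_X_pow
  simp only [hdeg, Finset.sum_range_succ, Finset.sum_range_zero, c0, c3] at hsum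
  rcases zmod_cases (p.coeff 1) with c1 | c1 <;> rcases zmod_cases (p.coeff 2) with c2 | c2 <;>
    simp only [c1, c2, map_zero, map_one] at hsum <;> rw [hsum]
  · refine ⟨6, by decide, Polynomial.X ^ 2 + Polynomial.X + 1, ?_⟩
    simp [Finset.sum_range_succ]
    ring
  · refine ⟨7, by decide, Polynomial.X ^ 3 + Polynomial.X + 1, ?_⟩
    simp [Finset.sum_range_succ]
    linear_combination (-Polynomial.X ^ 3) * two_eq_zero
  · refine ⟨7, by decide, Polynomial.X ^ 3 + Polynomial.X ^ 2 + 1, ?_⟩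
    simp [Finset.sum_range_succ]
    linear_combination (-Polynomial.X ^ 3) * two_eq_zero
  · refine ⟨4, by decide, 1, ?_⟩
    simp [Finset.sum_range_succ]

/-- **Affine orbits in `𝔽₂³` collide within 8 steps.** For every invertible `3 × 3` matrix `A`
over `ZMod 2`, every `b` and every starting point `x`, the eight iterates
`f^[0](x), …, f^[7](x)` of `f(y) = A.mulVec y + b` are not pairwise distinct. -/
theorem affine_iterates_not_pairwise_distinct (A : Matrix (Fin 3) (Fin 3) (ZMod 2))
    (hA : IsUnit A) (b x : Fin 3 → ZMod 2) :
    ∃ i j : Fin 8, i ≠ j ∧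
      (fun y => A.mulVec y + b)^[(i : ℕ)] x = (fun y => A.mulVec y + b)^[(j : ℕ)] x := by
  have h0 : A.charpoly.coeff 0 ≠ 0 := fun h =>
    ((Matrix.isUnit_iff_isUnit_det A).mp hA).ne_zero (by
      rw [Matrix.det_eq_sign_charpoly_coeff, h, mul_zero])
  obtain ⟨n, hn, hdvd⟩ := Polynomial.dvd_geom_sum_of_monic_cubic_zmod_two A.charpoly_monic
    (by simp) h0
  refine ⟨n, 0, hn, ?_⟩
  have hsum : ∑ k ∈ Finset.range n, A ^ k = 0 := by
    simpa using Polynomial.aeval_eq_zero_of_dvd_aeval_eq_zero hdvd A.aeval_self_charpoly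
  simp [Matrix.iterate_mulVec_add, hsum]
end
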